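/- Let a, d₁, d₂ > 0. If √(d₁/d₂) > (√(1+a²) − 1)/a, then κ(ξ, b) > 0 for all ξ ∈ ℝ and all b ≤ 1 + a². Moreover, (√(1+a²) − 1)/a < 1 for every a > 0, so in particular the hypothesis holds whenever d₁ ≥ d₂. -/

import Mathlib

/-- `κ(ξ, b) = a² + (a²d₁ + (1 - b)d₂)ξ² + d₁d₂ξ⁴`, the determinant of the
Brusselator linearization on Fourier modes. -/
noncomputable def brusselatorKappa (a b d₁ d₂ ξ : ℝ) : ℝ :=
  a ^ 2 + (a ^ 2 * d₁ + (1 - b) * d₂) * ξ ^ 2 + d₁ * d₂ * ξ ^ 4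

/-- Under the condition `√(d₁/d₂) > (√(1+a²) - 1)/a`, no Turing instability occurs
before the Hopf threshold `b_c = 1 + a²`: `κ(ξ, b) > 0` for all `ξ` and all
`b ≤ 1 + a²`.  Moreover `(√(1+a²) - 1)/a < 1` for every `a > 0`, so the condition
holds in particular whenever `d₁ ≥ d₂`. -/
theorem brusselator_no_turing (a d₁ d₂ : ℝ) (ha : 0 < a) (hd₁ : 0 < d₁) (hd₂ : 0 < d₂) :
    (Real.sqrt (d₁ / d₂) > (Real.sqrt (1 + a ^ 2) - 1) / a →
      ∀ ξ b : ℝ, b ≤ 1 + a ^ 2 → 0 < brusselatorKappa a b d₁ d₂ ξ) ∧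
    ((Real.sqrt (1 + a ^ 2) - 1) / a < 1) ∧
    (d₂ ≤ d₁ → Real.sqrt (d₁ / d₂) > (Real.sqrt (1 + a ^ 2) - 1) / a) := by
  have hR : Real.sqrt (1 + a ^ 2) < 1 + a := by
    rw [Real.sqrt_lt' (by linarith)]
    nlinarith
  have h1 : (Real.sqrt (1 + a ^ 2) - 1) / a < 1 := by
    rw [div_lt_one ha]
    linarith
  refine ⟨?_, h1, ?_⟩
  · intro h ξ b hb
    have hs0 : 0 ≤ Real.sqrt (d₁ / d₂) := Real.sqrt_nonneg _
    have hs2 : Real.sqrt (d₁ / d₂) ^ 2 = d₁ / d₂ := Real.sq_sqrt (by positivity)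
    generalize Real.sqrt (d₁ / d₂) = s at h hs0 hs2
    have hd : d₁ = s ^ 2 * d₂ := by
      rw [hs2]
      field_simp
    have h2 : Real.sqrt (1 + a ^ 2) < s * a + 1 := by
      have := (div_lt_iff₀ ha).1 h
      linarith
    rw [Real.sqrt_lt' (by positivity)] at h2
    have hc : 0 < 2 * a * s + a ^ 2 * s ^ 2 - a ^ 2 := by nlinarith
    have hb' : 0 ≤ (1 + a ^ 2 - b) * (d₂ * ξ ^ 2) :=
      mul_nonneg (by linarith) (by positivity)
    have key : brusselatorKappa a b d₁ d₂ ξ = (a - s * (d₂ * ξ ^ 2)) ^ 2 +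
        (2 * a * s + a ^ 2 * s ^ 2 - a ^ 2) * (d₂ * ξ ^ 2) +
        (1 + a ^ 2 - b) * (d₂ * ξ ^ 2) := by
      unfold brusselatorKappa
      rw [hd]
      ring
    rw [key]
    rcases eq_or_ne ξ 0 with h0 | h0
    · subst h0
      have : 0 < a ^ 2 := by positivity
      simpa using this
    · have hy : 0 < d₂ * ξ ^ 2 := by positivity
      have := mul_pos hc hy
      have := sq_nonneg (a - s * (d₂ * ξ ^ 2))
      linarith
  · intro h
    have : 1 ≤ Real.sqrt (d₁ / d₂) := by
      rw [Real.one_le_sqrt, one_le_div hd₂]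
      exact h
    linarith
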